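/- Let K and K' be non-degenerate CMIs with can(pur(K)) = (C, ⟨𝕀_K, 𝕀_K, P_1,…,P_t⟩) and can(pur(K')) = (C', ⟨𝕀_{K'}, 𝕀_{K'}, P'_1,…,P'_s⟩) (general notation). If K is valid for a given joint distribution and C ⊆ C', then J(X_{𝕀_{K'}}, X_{𝕀_{K'}}, X_{P'_1},…,X_{P'_s} | X_{C'}) = J(X_{𝕀_{K'}\𝕀_K}, X_{𝕀_{K'}\𝕀_K}, X_{P'_1\𝕀_K},…,X_{P'_s\𝕀_K} | X_{C'\𝕀_K}). -/

import Mathlib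

open scoped Classical

namespace Paper

variable {n : ℕ}

/-- The marginal distribution of the coordinates in `α` of a joint distribution `p` of
the discrete random variables `X_1, …, X_n` (each taking countably many values, coded
as natural numbers). -/
noncomputable def marginal (p : PMF (Fin n → ℕ)) (α : Finset (Fin n)) :
    PMF ({ i // i ∈ α } → ℕ) :=
  p.map fun x i => x i.1

/-- The Shannon (joint) entropy `H(X_α)`. -/
noncomputable def Hm (p : PMF (Fin n → ℕ)) (α : Finset (Fin n)) : ℝ :=
  ∑' y, Real.negMulLog ((marginal p α) y).toReal

/-- The conditional entropy `H(X_β | X_α) = H(X_{β ∪ α}) - H(X_α)`. -/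
noncomputable def Hc (p : PMF (Fin n → ℕ)) (β α : Finset (Fin n)) : ℝ :=
  Hm p (β ∪ α) - Hm p α

/-- Every individual random variable `X_i` has finite Shannon entropy
(the series defining `H(X_i)` is summable). -/
def FiniteEntropy (p : PMF (Fin n → ℕ)) : Prop :=
  ∀ i : Fin n, Summable fun y : ℕ => Real.negMulLog ((p.map fun x => x i) y).toReal

/-- `J(X_{Q_1}, …, X_{Q_k} | X_C) = (∑ i, H(X_{Q_i}|X_C)) - H(X_{Q_1},…,X_{Q_k}|X_C)`;
the joint conditional entropy of the tuple `(X_{Q_1},…,X_{Q_k})` equals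
`H(X_{∪ i, Q_i} | X_C)` since the two tuples determine each other. -/
noncomputable def J (p : PMF (Fin n → ℕ)) (C : Finset (Fin n))
    (Qs : Multiset (Finset (Fin n))) : ℝ :=
  (Qs.map fun Q => Hc p Q C).sum - Hc p Qs.sup C

/-- A conditional mutual independency (CMI) on `{1, …, n}`: a conditioning set `C`
together with a finite multiset `⟨Q_1, …, Q_k⟩` of subsets of `{1, …, n}`. -/
structure CMI (n : ℕ) where
  C : Finset (Fin n)
  Qs : Multiset (Finset (Fin n))

/-- `K` is valid for the joint distribution `p`. -/
def Valid (p : PMF (Fin n → ℕ)) (K : CMI n) : Prop :=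
  J p K.C K.Qs = 0

/-- `K` is degenerate: valid for every finite-entropy joint distribution. -/
def Degenerate (K : CMI n) : Prop :=
  ∀ p : PMF (Fin n → ℕ), FiniteEntropy p → Valid p K

/-- `K ∼ K'`: valid for exactly the same finite-entropy joint distributions. -/
def Equivalent (K K' : CMI n) : Prop :=
  ∀ p : PMF (Fin n → ℕ), FiniteEntropy p → (Valid p K ↔ Valid p K')

/-- `K` implies `K'`. -/
def Implies (K K' : CMI n) : Prop :=
  ∀ p : PMF (Fin n → ℕ), FiniteEntropy p → Valid p K → Valid p K'

/-- `K` is in pure form: every `Q_i` is nonempty and disjoint from `C`. -/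
def IsPure (K : CMI n) : Prop :=
  ∀ Q ∈ K.Qs, Q ≠ ∅ ∧ Q ∩ K.C = ∅

/-- The pure form `pur(K) = (C, ⟨Q_i \ C : Q_i \ C ≠ ∅⟩)`. -/
noncomputable def pur (K : CMI n) : CMI n :=
  ⟨K.C, (K.Qs.map fun Q => Q \ K.C).filter fun Q => Q ≠ ∅⟩

/-- The set `𝕀_K` of repeated indices of `K`: indices lying in `Q_i ∩ Q_j` for two
distinct entries `i ≠ j` of the multiset (automatically `∅` when `k ≤ 1`). -/
noncomputable def repSet (K : CMI n) : Finset (Fin n) :=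
  Finset.univ.filter fun q => 2 ≤ Multiset.card (K.Qs.filter fun Q => q ∈ Q)

/-- The multiset `⟨P_1, …, P_t⟩` of nonempty sets among the `Q_i \ 𝕀_K`. -/
noncomputable def parts (K : CMI n) : Multiset (Finset (Fin n)) :=
  (K.Qs.map fun Q => Q \ repSet K).filter fun P => P ≠ ∅

/-- The multiset of the `P_j`-entries of the canonical form `can(K)`
(general notation). -/
noncomputable def canParts (K : CMI n) : Multiset (Finset (Fin n)) :=
  if Multiset.card K.Qs ≤ 1 then 0
  else if repSet K ≠ ∅ ∧ Multiset.card (parts K) ≤ 1 then 0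
  else parts K

/-- The canonical form `can(K)` (of a pure-form CMI); all degenerate canonical forms
`(·,⟨⟩)` are represented by `⟨∅, 0⟩`. -/
noncomputable def can (K : CMI n) : CMI n :=
  if Multiset.card K.Qs ≤ 1 then ⟨∅, 0⟩
  else if repSet K = ∅ then ⟨K.C, parts K⟩
  else if Multiset.card (parts K) ≤ 1 then ⟨K.C, {repSet K, repSet K}⟩
  else ⟨K.C, repSet K ::ₘ repSet K ::ₘ parts K⟩

/-- `R_K^{K'}`: the CMI "`K'` conditioning on `K`"; the degenerate case `(·,⟨⟩)` is
represented by `⟨∅, 0⟩`. -/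
noncomputable def RCond (K K' : CMI n) : CMI n :=
  let I := repSet (pur K)
  let I' := repSet (pur K')
  let Ts := ((canParts (pur K')).map fun P => P \ I).filter fun T => T ≠ ∅
  if I' \ I = ∅ ∧ Multiset.card Ts ≤ 1 then ⟨∅, 0⟩
  else if I' \ I = ∅ then ⟨K'.C \ I, Ts⟩
  else if Multiset.card Ts ≤ 1 then ⟨K'.C \ I, {I' \ I, I' \ I}⟩
  else ⟨K'.C \ I, (I' \ I) ::ₘ (I' \ I) ::ₘ Ts⟩

section Entropy

variable (p : PMF (Fin n → ℕ))

/-- The probability that the coordinates in `A` agree with those of `x`. -/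
noncomputable def agreeProb (A : Finset (Fin n)) (x : Fin n → ℕ) : ENNReal :=
  ∑' w, if ∀ i ∈ A, x i = w i then p w else 0

/-- The Shannon entropy of `X_A` as an extended nonnegative real, written as the expected
surprisal. -/
noncomputable def extEntropy (A : Finset (Fin n)) : ENNReal :=
  ∑' x, p x * ENNReal.ofReal (-Real.log (agreeProb p A x).toReal)

theorem tsum_map_mul {Ω S : Type*} (q : PMF Ω) (f : Ω → S) (φ : S → ENNReal) :
    ∑' y, (q.map f) y * φ y = ∑' x, q x * φ (f x) := by
  simp_rw [PMF.map_apply, ← ENNReal.tsum_mul_right]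
  rw [ENNReal.tsum_comm]
  refine tsum_congr fun x => ?_
  rw [tsum_eq_single (f x)]
  · simp
  · intro y hy
    simp [hy]

theorem ofReal_negMulLog_toReal {a : ENNReal} (ha : a ≠ ⊤) :
    ENNReal.ofReal (Real.negMulLog a.toReal) = a * ENNReal.ofReal (-Real.log a.toReal) := by
  rw [Real.negMulLog, neg_mul, ← mul_neg, ENNReal.ofReal_mul ENNReal.toReal_nonneg,
    ENNReal.ofReal_toReal ha]

theorem tsum_negMulLog_map {Ω S : Type*} (q : PMF Ω) (f : Ω → S) :
    ∑' y, ENNReal.ofReal (Real.negMulLog ((q.map f) y).toReal) =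
      ∑' x, q x * ENNReal.ofReal (-Real.log ((q.map f) (f x)).toReal) := by
  rw [← tsum_map_mul q f fun y => ENNReal.ofReal (-Real.log ((q.map f) y).toReal)]
  exact tsum_congr fun y => ofReal_negMulLog_toReal (PMF.apply_ne_top _ _)

theorem negMulLog_pmf_nonneg {S : Type*} (q : PMF S) (y : S) :
    0 ≤ Real.negMulLog (q y).toReal :=
  Real.negMulLog_nonneg ENNReal.toReal_nonneg
    (by simpa using ENNReal.toReal_mono ENNReal.one_ne_top (q.coe_le_one y))

theorem marginal_apply_restrict (A : Finset (Fin n)) (x : Fin n → ℕ) :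
    marginal p A (fun i => x i.1) = agreeProb p A x := by
  rw [marginal, PMF.map_apply, agreeProb]
  refine tsum_congr fun w => ?_
  congr 1
  simp [funext_iff]

theorem Hm_eq_toReal_extEntropy (A : Finset (Fin n)) : Hm p A = (extEntropy p A).toReal := by
  have h := tsum_negMulLog_map p (fun x (i : { i // i ∈ A }) => x i.1)
  change ∑' y, ENNReal.ofReal (Real.negMulLog ((marginal p A) y).toReal) =
    ∑' x, p x * ENNReal.ofReal (-Real.log (marginal p A (fun i => x i.1)).toReal) at h
  simp_rw [marginal_apply_restrict] at h
  rw [extEntropy, ← h, ENNReal.tsum_toReal_eq fun _ => ENNReal.ofReal_ne_top, Hm]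
  exact tsum_congr fun y => (ENNReal.toReal_ofReal (negMulLog_pmf_nonneg _ _)).symm

theorem agreeProb_le_one (A : Finset (Fin n)) (x : Fin n → ℕ) : agreeProb p A x ≤ 1 := by
  rw [← marginal_apply_restrict]
  exact PMF.coe_le_one _ _

theorem agreeProb_ne_top (A : Finset (Fin n)) (x : Fin n → ℕ) : agreeProb p A x ≠ ⊤ :=
  ne_top_of_le_ne_top ENNReal.one_ne_top (agreeProb_le_one p A x)

theorem le_agreeProb (A : Finset (Fin n)) (x : Fin n → ℕ) : p x ≤ agreeProb p A x := by
  have h := ENNReal.le_tsum (f := fun w => if ∀ i ∈ A, x i = w i then p w else 0) x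
  simpa [agreeProb] using h

theorem agreeProb_ne_zero (A : Finset (Fin n)) {x : Fin n → ℕ} (hx : p x ≠ 0) :
    agreeProb p A x ≠ 0 := fun h => hx (le_antisymm (h ▸ le_agreeProb p A x) zero_le)

theorem agreeProb_anti {A B : Finset (Fin n)} (h : A ⊆ B) (x : Fin n → ℕ) :
    agreeProb p B x ≤ agreeProb p A x := by
  refine ENNReal.tsum_le_tsum fun w => ?_
  split_ifs with h₁ h₂
  · exact le_rfl
  · exact absurd (fun i hi => h₁ i (h hi)) h₂
  · exact zero_le
  · exact le_rfl

theorem agreeProb_congr {A : Finset (Fin n)} {x y : Fin n → ℕ} (h : ∀ i ∈ A, x i = y i) :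
    agreeProb p A x = agreeProb p A y := by
  refine tsum_congr fun w => ?_
  congr 1
  exact propext ⟨fun H i hi => (h i hi).symm.trans (H i hi),
    fun H i hi => (h i hi).trans (H i hi)⟩

theorem extEntropy_mono {A B : Finset (Fin n)} (h : A ⊆ B) :
    extEntropy p A ≤ extEntropy p B := by
  refine ENNReal.tsum_le_tsum fun x => ?_
  by_cases hx : p x = 0
  · simp [hx]
  refine mul_le_mul_right (ENNReal.ofReal_le_ofReal (neg_le_neg (Real.log_le_log ?_ ?_))) _
  · exact ENNReal.toReal_pos (agreeProb_ne_zero p B hx) (agreeProb_ne_top p B x)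
  · exact ENNReal.toReal_mono (agreeProb_ne_top p A x) (agreeProb_anti p h x)

theorem tsum_agree_div_le (A B : Finset (Fin n)) (w v : Fin n → ℕ) :
    (∑' x, if (∀ i ∈ A, x i = w i) ∧ ∀ i ∈ B, x i = v i then p x / agreeProb p (A ∪ B) x else 0)
      ≤ if ∀ i ∈ A ∩ B, w i = v i then 1 else 0 := by
  by_cases h : ∃ x₀ : Fin n → ℕ, (∀ i ∈ A, x₀ i = w i) ∧ ∀ i ∈ B, x₀ i = v i
  · obtain ⟨x₀, hA, hB⟩ := h
    have hM : ∀ i ∈ A ∩ B, w i = v i := fun i hi =>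
      (hA i (Finset.mem_inter.1 hi).1).symm.trans (hB i (Finset.mem_inter.1 hi).2)
    rw [if_pos hM]
    calc _ = ∑' x, (if ∀ i ∈ A ∪ B, x₀ i = x i then p x else 0) / agreeProb p (A ∪ B) x₀ := by
          refine tsum_congr fun x => ?_
          have hiff : ((∀ i ∈ A, x i = w i) ∧ ∀ i ∈ B, x i = v i) ↔
              ∀ i ∈ A ∪ B, x₀ i = x i := by
            constructor
            · rintro ⟨h₁, h₂⟩ i hi
              rcases Finset.mem_union.1 hi with hi | hi
              · rw [hA i hi, h₁ i hi]
              · rw [hB i hi, h₂ i hi]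
            · intro H
              exact ⟨fun i hi => by rw [← H i (Finset.mem_union_left _ hi), hA i hi],
                fun i hi => by rw [← H i (Finset.mem_union_right _ hi), hB i hi]⟩
          by_cases hx : ∀ i ∈ A ∪ B, x₀ i = x i
          · rw [if_pos (hiff.2 hx), if_pos hx, agreeProb_congr p hx]
          · rw [if_neg (mt hiff.1 hx), if_neg hx, ENNReal.zero_div]
      _ = agreeProb p (A ∪ B) x₀ / agreeProb p (A ∪ B) x₀ := by
          simp_rw [div_eq_mul_inv, ENNReal.tsum_mul_right]
          rfl
      _ ≤ 1 := ENNReal.div_self_le_one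
  · push Not at h
    rw [ENNReal.tsum_eq_zero.2]
    · exact zero_le
    · intro x
      rw [if_neg]
      rintro ⟨h₁, h₂⟩
      obtain ⟨i, hi, hne⟩ := h x h₁
      exact hne (h₂ i hi)

theorem tsum_mul_ratio_le_one (A B : Finset (Fin n)) :
    ∑' x, p x * (agreeProb p A x * agreeProb p B x /
      (agreeProb p (A ∪ B) x * agreeProb p (A ∩ B) x)) ≤ 1 := by
  calc _ ≤ ∑' x, ∑' w, ∑' v, p w / agreeProb p (A ∩ B) w * (p v *
        if (∀ i ∈ A, x i = w i) ∧ ∀ i ∈ B, x i = v i then p x / agreeProb p (A ∪ B) x else 0) := by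
        refine ENNReal.tsum_le_tsum fun x => ?_
        have hsplit : p x * (agreeProb p A x * agreeProb p B x /
            (agreeProb p (A ∪ B) x * agreeProb p (A ∩ B) x)) =
            agreeProb p A x * (agreeProb p B x *
              (p x / agreeProb p (A ∪ B) x / agreeProb p (A ∩ B) x)) := by
          rw [div_eq_mul_inv, ENNReal.mul_inv (Or.inr (agreeProb_ne_top p _ x))
            (Or.inl (agreeProb_ne_top p _ x)), div_eq_mul_inv, div_eq_mul_inv]
          ring
        rw [hsplit]
        conv_lhs => rw [agreeProb, ← ENNReal.tsum_mul_right]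
        refine ENNReal.tsum_le_tsum fun w => ?_
        conv_lhs =>
          enter [2, 1]
          rw [agreeProb]
        rw [← ENNReal.tsum_mul_right, ← ENNReal.tsum_mul_left]
        refine ENNReal.tsum_le_tsum fun v => ?_
        by_cases hw : ∀ i ∈ A, x i = w i
        · by_cases hv : ∀ i ∈ B, x i = v i
          · rw [if_pos hw, if_pos hv, if_pos ⟨hw, hv⟩,
              agreeProb_congr p (fun i hi => hw i (Finset.mem_inter.1 hi).1)]
            simp only [div_eq_mul_inv]
            refine le_of_eq ?_
            ring
          · rw [if_neg hv]
            simp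
        · rw [if_neg hw]
          simp
    _ = ∑' w, p w / agreeProb p (A ∩ B) w * ∑' v, p v * ∑' x,
        if (∀ i ∈ A, x i = w i) ∧ ∀ i ∈ B, x i = v i then p x / agreeProb p (A ∪ B) x else 0 := by
        rw [ENNReal.tsum_comm]
        refine tsum_congr fun w => ?_
        rw [ENNReal.tsum_comm]
        simp_rw [ENNReal.tsum_mul_left]
    _ ≤ ∑' w, p w / agreeProb p (A ∩ B) w * agreeProb p (A ∩ B) w := by
        refine ENNReal.tsum_le_tsum fun w => mul_le_mul_right ?_ _
        refine ENNReal.tsum_le_tsum fun v => ?_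
        refine (mul_le_mul_right (tsum_agree_div_le p A B w v) _).trans (le_of_eq ?_)
        split_ifs <;> simp
    _ ≤ ∑' w, p w := ENNReal.tsum_le_tsum fun w => (mul_comm _ _).trans_le ENNReal.mul_div_le
    _ = 1 := p.tsum_coe

theorem neg_log_add_neg_log_add_one_le {a b u m : ℝ} (ha : 0 < a) (hb : 0 < b) (hu : 0 < u)
    (hm : 0 < m) :
    -Real.log u + -Real.log m + 1 ≤ -Real.log a + -Real.log b + a * b / (u * m) := by
  have h := Real.log_le_sub_one_of_pos (show 0 < a * b / (u * m) by positivity)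
  rw [Real.log_div (by positivity) (by positivity), Real.log_mul ha.ne' hb.ne',
    Real.log_mul hu.ne' hm.ne'] at h
  linarith

theorem surprisal_add_surprisal_add_one_le (A B : Finset (Fin n)) {x : Fin n → ℕ}
    (hx : p x ≠ 0) :
    ENNReal.ofReal (-Real.log (agreeProb p (A ∪ B) x).toReal) +
      ENNReal.ofReal (-Real.log (agreeProb p (A ∩ B) x).toReal) + 1 ≤
    ENNReal.ofReal (-Real.log (agreeProb p A x).toReal) +
      ENNReal.ofReal (-Real.log (agreeProb p B x).toReal) +
      agreeProb p A x * agreeProb p B x / (agreeProb p (A ∪ B) x * agreeProb p (A ∩ B) x) := by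
  have hpos : ∀ S, 0 < (agreeProb p S x).toReal := fun S =>
    ENNReal.toReal_pos (agreeProb_ne_zero p S hx) (agreeProb_ne_top p S x)
  have hlog : ∀ S, 0 ≤ -Real.log (agreeProb p S x).toReal := fun S =>
    neg_nonneg.2 (Real.log_nonpos (hpos S).le
      (by simpa using ENNReal.toReal_mono ENNReal.one_ne_top (agreeProb_le_one p S x)))
  have hratio : agreeProb p A x * agreeProb p B x /
      (agreeProb p (A ∪ B) x * agreeProb p (A ∩ B) x) =
      ENNReal.ofReal ((agreeProb p A x).toReal * (agreeProb p B x).toReal /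
        ((agreeProb p (A ∪ B) x).toReal * (agreeProb p (A ∩ B) x).toReal)) := by
    rw [ENNReal.ofReal_div_of_pos (mul_pos (hpos _) (hpos _)), ENNReal.ofReal_mul (hpos _).le,
      ENNReal.ofReal_mul (hpos _).le]
    simp only [ENNReal.ofReal_toReal (agreeProb_ne_top p _ x)]
  rw [hratio, ← ENNReal.ofReal_one, ← ENNReal.ofReal_add (hlog _) (hlog _),
    ← ENNReal.ofReal_add (hlog _) (hlog _),
    ← ENNReal.ofReal_add (add_nonneg (hlog _) (hlog _)) zero_le_one,
    ← ENNReal.ofReal_add (add_nonneg (hlog _) (hlog _))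
      (div_nonneg (mul_pos (hpos _) (hpos _)).le (mul_pos (hpos _) (hpos _)).le)]
  exact ENNReal.ofReal_le_ofReal
    (neg_log_add_neg_log_add_one_le (hpos _) (hpos _) (hpos _) (hpos _))

theorem extEntropy_submodular (A B : Finset (Fin n)) :
    extEntropy p (A ∪ B) + extEntropy p (A ∩ B) ≤ extEntropy p A + extEntropy p B := by
  refine ENNReal.le_of_add_le_add_right ENNReal.one_ne_top ?_
  calc extEntropy p (A ∪ B) + extEntropy p (A ∩ B) + 1
      = ∑' x, p x * (ENNReal.ofReal (-Real.log (agreeProb p (A ∪ B) x).toReal) +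
          ENNReal.ofReal (-Real.log (agreeProb p (A ∩ B) x).toReal) + 1) := by
        simp only [mul_add, ENNReal.tsum_add, mul_one, p.tsum_coe, extEntropy]
    _ ≤ ∑' x, p x * (ENNReal.ofReal (-Real.log (agreeProb p A x).toReal) +
          ENNReal.ofReal (-Real.log (agreeProb p B x).toReal) +
          agreeProb p A x * agreeProb p B x /
            (agreeProb p (A ∪ B) x * agreeProb p (A ∩ B) x)) := by
        refine ENNReal.tsum_le_tsum fun x => ?_
        by_cases hx : p x = 0
        · simp [hx]
        · exact mul_le_mul_right (surprisal_add_surprisal_add_one_le p A B hx) _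
    _ = extEntropy p A + extEntropy p B + ∑' x, p x * (agreeProb p A x * agreeProb p B x /
            (agreeProb p (A ∪ B) x * agreeProb p (A ∩ B) x)) := by
        simp only [mul_add, ENNReal.tsum_add, extEntropy]
    _ ≤ extEntropy p A + extEntropy p B + 1 := by
        gcongr
        exact tsum_mul_ratio_le_one p A B

theorem extEntropy_empty : extEntropy p ∅ = 0 := by
  simp [extEntropy, agreeProb, p.tsum_coe]

variable {p}

theorem extEntropy_singleton_ne_top (hp : FiniteEntropy p) (i : Fin n) :
    extEntropy p {i} ≠ ⊤ := by
  have h := tsum_negMulLog_map p fun x => x i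
  have hagree : ∀ x : Fin n → ℕ, (p.map fun x => x i) (x i) = agreeProb p {i} x := by
    intro x
    rw [PMF.map_apply, agreeProb]
    refine tsum_congr fun w => ?_
    congr 1
    simp
  simp_rw [hagree] at h
  rw [extEntropy, ← h]
  exact (hp i).tsum_ofReal_ne_top

theorem extEntropy_ne_top (hp : FiniteEntropy p) (A : Finset (Fin n)) :
    extEntropy p A ≠ ⊤ := by
  induction A using Finset.induction_on with
  | empty => simp [extEntropy_empty]
  | insert i A _ ih =>
    have h := extEntropy_submodular p {i} A
    rw [← Finset.insert_eq] at h
    exact ne_top_of_le_ne_top (ENNReal.add_ne_top.2 ⟨extEntropy_singleton_ne_top hp i, ih⟩)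
      (le_self_add.trans h)

theorem Hm_mono (hp : FiniteEntropy p) {A B : Finset (Fin n)} (h : A ⊆ B) :
    Hm p A ≤ Hm p B := by
  rw [Hm_eq_toReal_extEntropy, Hm_eq_toReal_extEntropy]
  exact ENNReal.toReal_mono (extEntropy_ne_top hp B) (extEntropy_mono p h)

theorem Hm_submodular (hp : FiniteEntropy p) (A B : Finset (Fin n)) :
    Hm p (A ∪ B) + Hm p (A ∩ B) ≤ Hm p A + Hm p B := by
  simp only [Hm_eq_toReal_extEntropy]
  rw [← ENNReal.toReal_add (extEntropy_ne_top hp _) (extEntropy_ne_top hp _),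
    ← ENNReal.toReal_add (extEntropy_ne_top hp _) (extEntropy_ne_top hp _)]
  exact ENNReal.toReal_mono
    (ENNReal.add_ne_top.2 ⟨extEntropy_ne_top hp _, extEntropy_ne_top hp _⟩)
    (extEntropy_submodular p A B)

theorem Hc_empty (C : Finset (Fin n)) : Hc p ∅ C = 0 := by
  simp [Hc]

theorem Hc_mono (hp : FiniteEntropy p) {A B : Finset (Fin n)} (h : A ⊆ B) (C : Finset (Fin n)) :
    Hc p A C ≤ Hc p B C :=
  sub_le_sub_right (Hm_mono hp (Finset.union_subset_union_left h)) _

theorem Hc_nonneg (hp : FiniteEntropy p) (A C : Finset (Fin n)) : 0 ≤ Hc p A C :=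
  sub_nonneg.2 (Hm_mono hp Finset.subset_union_right)

theorem Hc_submodular (hp : FiniteEntropy p) (A B C : Finset (Fin n)) :
    Hc p (A ∪ B) C + Hc p (A ∩ B) C ≤ Hc p A C + Hc p B C := by
  have h := Hm_submodular hp (A ∪ C) (B ∪ C)
  rw [← Finset.union_union_distrib_right, ← Finset.inter_union_distrib_right] at h
  simp only [Hc]
  linarith

theorem Hc_multiset_sup_le (hp : FiniteEntropy p) (C : Finset (Fin n))
    (Qs : Multiset (Finset (Fin n))) :
    Hc p Qs.sup C ≤ (Qs.map fun Q => Hc p Q C).sum := by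
  induction Qs using Multiset.induction_on with
  | empty => simp [Hc_empty]
  | cons Q Qs ih =>
    rw [Multiset.sup_cons, Multiset.map_cons, Multiset.sum_cons]
    have h := Hc_submodular hp Q Qs.sup C
    have h₀ := Hc_nonneg hp (Q ∩ Qs.sup) C
    change Hc p (Q ∪ Qs.sup) C ≤ _
    linarith

theorem Hc_singleton_le_J (hp : FiniteEntropy p) (C : Finset (Fin n))
    (Qs : Multiset (Finset (Fin n))) {q : Fin n}
    (hq : 2 ≤ Multiset.card (Qs.filter fun Q => q ∈ Q)) :
    Hc p {q} C ≤ J p C Qs := by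
  rw [J, le_sub_iff_add_le]
  induction Qs using Multiset.induction_on with
  | empty => simp at hq
  | cons Q Qs ih =>
    rw [Multiset.sup_cons, Multiset.map_cons, Multiset.sum_cons]
    have h := Hc_submodular hp Q Qs.sup C
    change Hc p {q} C + Hc p (Q ∪ Qs.sup) C ≤ _
    by_cases hQ : q ∈ Q
    · rw [Multiset.filter_cons_of_pos (p := fun R => q ∈ R) _ hQ, Multiset.card_cons] at hq
      obtain ⟨R, hR⟩ := Multiset.card_pos_iff_exists_mem.1 (Nat.le_of_succ_le_succ hq)
      rw [Multiset.mem_filter] at hR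
      have hsub : {q} ⊆ Q ∩ Qs.sup :=
        Finset.singleton_subset_iff.2
          (Finset.mem_inter.2 ⟨hQ, (show R ⊆ Qs.sup from Multiset.le_sup hR.1) hR.2⟩)
      have h₁ := Hc_mono hp hsub C
      have h₂ := Hc_multiset_sup_le hp C Qs
      linarith
    · rw [Multiset.filter_cons_of_neg (p := fun R => q ∈ R) _ hQ] at hq
      have h₀ := Hc_nonneg hp (Q ∩ Qs.sup) C
      have h₁ := ih hq
      linarith

theorem Hm_union_eq_of_Hc_singleton_eq_zero (hp : FiniteEntropy p) {C A : Finset (Fin n)}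
    (hCA : C ⊆ A) {I : Finset (Fin n)} (hI : ∀ q ∈ I, Hc p {q} C = 0) :
    Hm p (A ∪ I) = Hm p A := by
  induction I using Finset.induction_on with
  | empty => simp
  | insert q I _ ih =>
    rw [← ih fun r hr => hI r (Finset.mem_insert_of_mem hr)]
    refine le_antisymm ?_ (Hm_mono hp (Finset.union_subset_union_right (Finset.subset_insert _ _)))
    have h := Hm_submodular hp (A ∪ I) ({q} ∪ C)
    have hunion : A ∪ I ∪ ({q} ∪ C) = A ∪ insert q I := by
      ext i
      have := @hCA i
      simp only [Finset.mem_union, Finset.mem_insert, Finset.mem_singleton]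
      tauto
    have hinter : C ⊆ (A ∪ I) ∩ ({q} ∪ C) :=
      Finset.subset_inter (hCA.trans Finset.subset_union_left) Finset.subset_union_right
    have h₁ := Hm_mono hp hinter
    have h₂ := hI q (Finset.mem_insert_self _ _)
    rw [hunion] at h
    rw [Hc] at h₂
    linarith

end Entropy

theorem notMem_C_of_mem_repSet_pur {K : CMI n} {q : Fin n} (hq : q ∈ repSet (pur K)) :
    q ∉ K.C := by
  rw [repSet, Finset.mem_filter] at hq
  obtain ⟨R, hR⟩ := Multiset.card_pos_iff_exists_mem.1 (lt_of_lt_of_le two_pos hq.2)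
  simp only [pur, Multiset.mem_filter, Multiset.mem_map] at hR
  obtain ⟨⟨⟨Q, _, rfl⟩, _⟩, hqR⟩ := hR
  exact (Finset.mem_sdiff.1 hqR).2

theorem two_le_card_filter_of_mem_repSet_pur {K : CMI n} {q : Fin n}
    (hq : q ∈ repSet (pur K)) : 2 ≤ Multiset.card (K.Qs.filter fun Q => q ∈ Q) := by
  rw [repSet, Finset.mem_filter] at hq
  refine hq.2.trans ?_
  rw [pur, Multiset.filter_comm]
  refine (Multiset.card_le_card (Multiset.filter_le _ _)).trans ?_
  rw [Multiset.filter_map, Multiset.card_map]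
  exact Multiset.card_le_card
    (Multiset.monotone_filter_right _ fun Q hQ => (Finset.mem_sdiff.1 hQ).1)

theorem multiset_sup_map_sdiff (Qs : Multiset (Finset (Fin n))) (I : Finset (Fin n)) :
    (Qs.map fun Q => Q \ I).sup = Qs.sup \ I := by
  induction Qs using Multiset.induction_on with
  | empty => simp
  | cons Q Qs ih => rw [Multiset.map_cons, Multiset.sup_cons, Multiset.sup_cons, ih, sup_sdiff]

theorem J_sdiff_repSet {p : PMF (Fin n → ℕ)} (hp : FiniteEntropy p) {K : CMI n}
    (hval : Valid p K) {C' : Finset (Fin n)} (hCC : K.C ⊆ C') (Qs : Multiset (Finset (Fin n))) :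
    J p C' Qs = J p (C' \ repSet (pur K)) (Qs.map fun Q => Q \ repSet (pur K)) := by
  have hI : ∀ q ∈ repSet (pur K), Hc p {q} K.C = 0 := fun q hq =>
    le_antisymm
      ((Hc_singleton_le_J hp K.C K.Qs (two_le_card_filter_of_mem_repSet_pur hq)).trans_eq hval)
      (Hc_nonneg hp _ _)
  have hHm : ∀ A, K.C ⊆ A → Hm p (A \ repSet (pur K)) = Hm p A := by
    intro A hA
    have hCA : K.C ⊆ A \ repSet (pur K) := fun q hq =>
      Finset.mem_sdiff.2 ⟨hA hq, fun h => notMem_C_of_mem_repSet_pur h hq⟩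
    rw [← Hm_union_eq_of_Hc_singleton_eq_zero hp hCA hI, Finset.sdiff_union_self_eq_union,
      Hm_union_eq_of_Hc_singleton_eq_zero hp hA hI]
  have hHc : ∀ Q, Hc p (Q \ repSet (pur K)) (C' \ repSet (pur K)) = Hc p Q C' := by
    intro Q
    rw [Hc, Hc, ← Finset.union_sdiff_distrib, hHm _ (hCC.trans Finset.subset_union_right),
      hHm _ hCC]
  simp only [J, multiset_sup_map_sdiff, Multiset.map_map, Function.comp_def, hHc]

/-- if `K` is valid and `C ⊆ C'`, then
`J(X_{𝕀_{K'}},X_{𝕀_{K'}},X_{P'_1},…,X_{P'_s}|X_{C'})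
 = J(X_{𝕀_{K'}\𝕀_K},X_{𝕀_{K'}\𝕀_K},X_{P'_1\𝕀_K},…,X_{P'_s\𝕀_K}|X_{C'\𝕀_K})`. -/
theorem stmt13 {n : ℕ} (K K' : CMI n)
    (hdK : ¬ Degenerate K) (hdK' : ¬ Degenerate K')
    (p : PMF (Fin n → ℕ)) (hp : FiniteEntropy p)
    (hval : Valid p K) (hCC : K.C ⊆ K'.C) :
    J p K'.C (repSet (pur K') ::ₘ repSet (pur K') ::ₘ canParts (pur K')) =
      J p (K'.C \ repSet (pur K))
        ((repSet (pur K') \ repSet (pur K)) ::ₘ (repSet (pur K') \ repSet (pur K)) ::ₘ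
          (canParts (pur K')).map fun P => P \ repSet (pur K)) := by
  rw [J_sdiff_repSet hp hval hCC]
  simp only [Multiset.map_cons]

end Paper
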